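/- arXiv:1801.03071 — 4 statements merged into one kernel-verified Lean document; each statement's English description precedes it below -/
import Mathlib

section
/- Correlation complementarity: Let d ≥ 1 and let O₁, …, O_N be Hermitian d × d complex matrices satisfying O_j² = I for every j and O_j O_k = − O_k O_j for all j ≠ k (pairwise anticommutation). Then for every d × d density matrix ρ (positive semidefinite with trace 1), the squared expectation values satisfy Σ_{j=1}^{N} (Tr(ρ O_j))² ≤ 1. -/
open Matrix Complex ComplexOrder

/-- A real linear combination of pairwise anticommuting involutions squares to the sum of the
squares of its coefficients. -/
theorem sum_smul_mul_self_of_anticommute {ι A : Type*} [Fintype ι] [Ring A] [Algebra ℝ A]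
    (O : ι → A) (hsq : ∀ j, O j * O j = 1)
    (hanti : ∀ j k, j ≠ k → O j * O k = -(O k * O j)) (a : ι → ℝ) :
    (∑ j, a j • O j) * (∑ j, a j • O j) = (∑ j, a j ^ 2) • (1 : A) := by
  classical
  have expand : (∑ j, a j • O j) * (∑ j, a j • O j) = ∑ j, ∑ k, (a j * a k) • (O j * O k) := by
    simp only [Finset.sum_mul_sum, smul_mul_smul_comm]
  have swap : ∑ j, ∑ k, (a j * a k) • (O j * O k) = ∑ j, ∑ k, (a j * a k) • (O k * O j) := by
    rw [Finset.sum_comm]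
    exact Finset.sum_congr rfl fun j _ => Finset.sum_congr rfl fun k _ => by rw [mul_comm]
  have double : (2 : ℝ) • ((∑ j, a j • O j) * (∑ j, a j • O j))
      = (2 : ℝ) • ((∑ j, a j ^ 2) • (1 : A)) := by
    rw [two_smul, expand]
    nth_rewrite 2 [swap]
    simp only [← Finset.sum_add_distrib, ← smul_add]
    rw [Finset.sum_smul, Finset.smul_sum]
    refine Finset.sum_congr rfl fun j _ => ?_
    rw [Finset.sum_eq_single j]
    · rw [hsq, ← two_smul ℝ (1 : A), smul_comm, sq]
    · intro k _ hk
      rw [hanti j k hk.symm, neg_add_cancel, smul_zero]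
    · simp
  have half := congrArg (fun x => (2⁻¹ : ℝ) • x) double
  simpa [smul_smul] using half

/-- **Correlation complementarity.** For pairwise anticommuting dichotomic observables
`O 1, …, O N` on `ℂ^d` and any density matrix `ρ`, the squared expectation values satisfy
`∑ j, (Tr(ρ O j))² ≤ 1`. -/
theorem correlation_complementarity {d N : ℕ} (hd : 1 ≤ d)
    (O : Fin N → Matrix (Fin d) (Fin d) ℂ)
    (hherm : ∀ j, (O j).IsHermitian)
    (hsq : ∀ j, O j * O j = 1)
    (hanti : ∀ j k : Fin N, j ≠ k → O j * O k = -(O k * O j))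
    (ρ : Matrix (Fin d) (Fin d) ℂ) (hρ : ρ.PosSemidef) (htr : ρ.trace = 1) :
    ∑ j : Fin N, ((ρ * O j).trace.re) ^ 2 ≤ 1 := by
  set a : Fin N → ℝ := fun j => (ρ * O j).trace.re with ha
  set A : Matrix (Fin d) (Fin d) ℂ := ∑ j, a j • O j with hA
  have hAA : A * A = (∑ j, a j ^ 2) • (1 : Matrix (Fin d) (Fin d) ℂ) :=
    sum_smul_mul_self_of_anticommute O hsq hanti a
  have hAherm : Aᴴ = A := by
    simp only [hA, conjTranspose_sum, conjTranspose_smul, (hherm _).eq, star_trivial]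
  have hρA : (ρ * A).trace.re = ∑ j, a j ^ 2 := by
    simp only [hA, Finset.mul_sum, trace_sum, mul_smul_comm, trace_smul, Complex.re_sum,
      Complex.smul_re, smul_eq_mul, ha, sq]
  have hnonneg : 0 ≤ ((A - 1) * ρ * (A - 1)ᴴ).trace.re :=
    (Complex.le_def.mp (hρ.mul_mul_conjTranspose_same (A - 1)).trace_nonneg).1
  have hsquare : (A - 1) * (A - 1) = A * A - A - A + 1 := by noncomm_ring
  rw [conjTranspose_sub, hAherm, conjTranspose_one, mul_assoc, trace_mul_comm, mul_assoc,
    hsquare, hAA] at hnonneg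
  simp only [mul_add, mul_sub, mul_smul_comm, mul_one, trace_add, trace_sub, trace_smul, htr,
    Complex.add_re, Complex.sub_re, Complex.smul_re, Complex.one_re, smul_eq_mul, hρA]
    at hnonneg
  linarith
end

section
/- Elementary bipartite Bell monogamy: For every 3-qubit density matrix ρ, the xy-plane Bell strengths of the pairs (1,2) and (1,3) satisfy 𝒯²₁₂(ρ) + 𝒯²₁₃(ρ) ≤ 2, i.e. Σ_{k,l∈{x,y}} (Tr(ρ σ_k^{(1)} σ_l^{(2)}))² + Σ_{k,l∈{x,y}} (Tr(ρ σ_k^{(1)} σ_l^{(3)}))² ≤ 2. -/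
open Matrix Complex ComplexOrder

noncomputable section

/-- The Pauli X matrix. -/
def pX : Matrix (Fin 2) (Fin 2) ℂ := !![0, 1; 1, 0]

/-- The Pauli Y matrix. -/
def pY : Matrix (Fin 2) (Fin 2) ℂ := !![0, -Complex.I; Complex.I, 0]

/-- The Pauli Z matrix. -/
def pZ : Matrix (Fin 2) (Fin 2) ℂ := !![1, 0; 0, -1]

/-- The operator on `n` qubits acting as the single-qubit operator `M` on qubit `i`
and as the identity on all other qubits. -/
def onQubit {n : ℕ} (M : Matrix (Fin 2) (Fin 2) ℂ) (i : Fin n) :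
    Matrix (Fin n → Fin 2) (Fin n → Fin 2) ℂ :=
  Matrix.of fun a b => ∏ s, if s = i then M (a s) (b s) else (if a s = b s then 1 else 0)

/-- An `n`-qubit density matrix: positive semidefinite with unit trace. -/
def IsDensityMatrix {n : ℕ} (ρ : Matrix (Fin n → Fin 2) (Fin n → Fin 2) ℂ) : Prop :=
  ρ.PosSemidef ∧ ρ.trace = 1

/-- The two Pauli matrices spanning the xy plane. -/
def XY : Fin 2 → Matrix (Fin 2) (Fin 2) ℂ := ![pX, pY]

/-- The two Pauli matrices spanning the xz plane. -/
def XZ : Fin 2 → Matrix (Fin 2) (Fin 2) ℂ := ![pX, pZ]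

/-- The xy-plane Bell strength 𝒯²_{ij}(ρ) of the pair of qubits (i,j). -/
def T2pair {n : ℕ} (ρ : Matrix (Fin n → Fin 2) (Fin n → Fin 2) ℂ) (i j : Fin n) : ℝ :=
  ∑ k : Fin 2, ∑ l : Fin 2,
    ((ρ * (onQubit (XY k) i * onQubit (XY l) j)).trace.re) ^ 2

/-- The xy-plane Bell strength 𝒯²_{ijm}(ρ) of the triple of qubits (i,j,m). -/
def T2triple {n : ℕ} (ρ : Matrix (Fin n → Fin 2) (Fin n → Fin 2) ℂ) (i j m : Fin n) : ℝ :=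
  ∑ k : Fin 2, ∑ l : Fin 2, ∑ p : Fin 2,
    ((ρ * (onQubit (XY k) i * onQubit (XY l) j * onQubit (XY p) m)).trace.re) ^ 2

/-- The xy-plane Bell strength 𝒯²_{ijml}(ρ) of the quadruple of qubits (i,j,m,l). -/
def T2quad {n : ℕ} (ρ : Matrix (Fin n → Fin 2) (Fin n → Fin 2) ℂ) (i j m l : Fin n) : ℝ :=
  ∑ k : Fin 2, ∑ k' : Fin 2, ∑ k'' : Fin 2, ∑ k''' : Fin 2,
    ((ρ * (onQubit (XY k) i * onQubit (XY k') j * onQubit (XY k'') m *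
        onQubit (XY k''') l)).trace.re) ^ 2

/-- The xz-plane Bell strength of the pair of qubits (i,j). -/
def T2pairXZ {n : ℕ} (ρ : Matrix (Fin n → Fin 2) (Fin n → Fin 2) ℂ) (i j : Fin n) : ℝ :=
  ∑ k : Fin 2, ∑ l : Fin 2,
    ((ρ * (onQubit (XZ k) i * onQubit (XZ l) j)).trace.re) ^ 2

open Finset

/-- The entries of `onQubit M i` split off the factor of qubit `i`. -/
lemma onQubit_apply {n : ℕ} (M : Matrix (Fin 2) (Fin 2) ℂ) (i : Fin n) (a b : Fin n → Fin 2) :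
    onQubit M i a b =
      M (a i) (b i) * ∏ s ∈ univ.erase i, if a s = b s then (1 : ℂ) else 0 := by
  simp only [onQubit, Matrix.of_apply]
  rw [← mul_prod_erase univ _ (mem_univ i), if_pos rfl]
  congr 1
  exact prod_congr rfl fun s hs => if_neg (ne_of_mem_erase hs)

lemma onQubit_add {n : ℕ} (M N : Matrix (Fin 2) (Fin 2) ℂ) (i : Fin n) :
    onQubit (M + N) i = onQubit M i + onQubit N i := by
  ext a b
  simp only [Matrix.add_apply, onQubit_apply, add_mul]

lemma onQubit_zero {n : ℕ} (i : Fin n) : onQubit 0 i = 0 := by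
  ext a b
  simp [onQubit_apply]

lemma onQubit_one {n : ℕ} (i : Fin n) : onQubit 1 i = 1 := by
  ext a b
  simp [onQubit, Matrix.one_apply, prod_ite_zero, funext_iff]

lemma onQubit_conjTranspose {n : ℕ} (M : Matrix (Fin 2) (Fin 2) ℂ) (i : Fin n) :
    (onQubit M i)ᴴ = onQubit Mᴴ i := by
  ext a b
  simp [onQubit_apply, Matrix.conjTranspose_apply, apply_ite, eq_comm]

/-- Tensor products of matrices multiply factorwise. -/
lemma of_prod_mul_of_prod {n : ℕ} (f g : Fin n → Matrix (Fin 2) (Fin 2) ℂ) :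
    (Matrix.of fun a b : Fin n → Fin 2 => ∏ s, f s (a s) (b s)) *
        (Matrix.of fun a b : Fin n → Fin 2 => ∏ s, g s (a s) (b s)) =
      Matrix.of fun a b : Fin n → Fin 2 => ∏ s, (f s * g s) (a s) (b s) := by
  ext a b
  simp only [Matrix.mul_apply, Matrix.of_apply, ← prod_mul_distrib]
  exact (Fintype.prod_sum fun s c => f s (a s) c * g s c (b s)).symm

lemma onQubit_eq_of_prod {n : ℕ} (M : Matrix (Fin 2) (Fin 2) ℂ) (i : Fin n) :
    onQubit M i = Matrix.of fun a b : Fin n → Fin 2 =>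
      ∏ s, (if s = i then M else 1) (a s) (b s) := by
  ext a b
  simp only [onQubit, Matrix.of_apply]
  refine prod_congr rfl fun s _ => ?_
  split_ifs <;> simp_all [Matrix.one_apply]

lemma onQubit_mul {n : ℕ} (M N : Matrix (Fin 2) (Fin 2) ℂ) (i : Fin n) :
    onQubit M i * onQubit N i = onQubit (M * N) i := by
  simp only [onQubit_eq_of_prod, of_prod_mul_of_prod]
  ext a b
  simp only [Matrix.of_apply]
  refine prod_congr rfl fun s _ => ?_
  split_ifs <;> simp

lemma onQubit_comm {n : ℕ} (M N : Matrix (Fin 2) (Fin 2) ℂ) {i j : Fin n} (hij : i ≠ j) :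
    onQubit M i * onQubit N j = onQubit N j * onQubit M i := by
  simp only [onQubit_eq_of_prod, of_prod_mul_of_prod]
  ext a b
  simp only [Matrix.of_apply]
  refine prod_congr rfl fun s _ => ?_
  split_ifs <;> simp_all

lemma XY_isHermitian (k : Fin 2) : (XY k)ᴴ = XY k := by
  fin_cases k <;> ext a b <;> fin_cases a <;> fin_cases b <;> simp [XY, pX, pY]

lemma XY_mul_self (k : Fin 2) : XY k * XY k = 1 := by
  fin_cases k <;> ext a b <;> fin_cases a <;> fin_cases b <;> simp [XY, pX, pY]

lemma XY_anticomm {k l : Fin 2} (h : k ≠ l) : XY k * XY l + XY l * XY k = 0 := by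
  fin_cases k <;> fin_cases l <;> first | exact absurd rfl h | skip
  all_goals ext a b; fin_cases a <;> fin_cases b <;> simp [XY, pX, pY]

/-- For a family of pairwise anticommuting Hermitian involutions, the squared expectation values
in a state sum to at most one. -/
lemma sum_sq_trace_le_one {m ι : Type*} [Fintype m] [DecidableEq m] [Fintype ι]
    {ρ : Matrix m m ℂ} (hρ : ρ.PosSemidef) (htr : ρ.trace = 1) (A : ι → Matrix m m ℂ)
    (hA : ∀ i, (A i)ᴴ = A i) (hsq : ∀ i, A i * A i = 1)
    (hanti : ∀ i j, i ≠ j → A i * A j + A j * A i = 0) :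
    ∑ i, ((ρ * A i).trace.re) ^ 2 ≤ 1 := by
  classical
  set t : ι → ℝ := fun i => (ρ * A i).trace.re with ht
  set S : ℝ := ∑ i, t i ^ 2 with hS
  set M : Matrix m m ℂ := ∑ i, t i • A i with hM
  have hMM : M * M = S • (1 : Matrix m m ℂ) := by
    have hexp : M * M = ∑ i, ∑ j, (t i * t j) • (A i * A j) := by
      simp only [hM, sum_mul_sum, smul_mul_smul_comm]
    have htwice : M * M + M * M = S • (1 : Matrix m m ℂ) + S • (1 : Matrix m m ℂ) := by
      calc M * M + M * M
          = ∑ i, ∑ j, (t i * t j) • (A i * A j + A j * A i) := by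
            nth_rewrite 2 [hexp]
            rw [sum_comm, hexp]
            simp only [← sum_add_distrib, smul_add]
            refine sum_congr rfl fun i _ => sum_congr rfl fun j _ => ?_
            rw [mul_comm (t j)]
        _ = ∑ i, (t i ^ 2) • ((1 : Matrix m m ℂ) + 1) := by
            refine sum_congr rfl fun i _ => ?_
            rw [sum_eq_single i (fun j _ hj => by rw [hanti i j hj.symm, smul_zero]) (by simp),
              hsq, pow_two]
        _ = S • (1 : Matrix m m ℂ) + S • (1 : Matrix m m ℂ) := by
            rw [← sum_smul, smul_add]
    rw [← two_smul ℝ, ← two_smul ℝ (S • _)] at htwice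
    exact smul_right_injective _ (two_ne_zero (α := ℝ)) htwice
  have hMH : (1 - M)ᴴ = 1 - M := by
    simp [hM, Matrix.conjTranspose_sum, hA]
  have hρM : (ρ * M).trace.re = S := by
    simp [hM, mul_sum, Matrix.trace_sum, hS, ht, pow_two]
  have hpos : 0 ≤ (ρ * ((1 - M) * (1 - M))).trace.re := by
    have h := (hρ.conjTranspose_mul_mul_same (1 - M)).trace_nonneg
    rw [hMH, Matrix.trace_mul_comm, ← mul_assoc, Matrix.trace_mul_comm] at h
    exact (Complex.le_def.1 h).1
  have hexpand : ρ * ((1 - M) * (1 - M)) = ρ - ρ * M - ρ * M + S • ρ := by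
    rw [show (1 - M) * (1 - M) = 1 - M - M + M * M by noncomm_ring, hMM]
    simp [mul_add, mul_sub]
  rw [hexpand] at hpos
  simp [hρM, htr] at hpos
  linarith

/-- The half of the monogamy relation carried by one family of anticommuting observables: qubit `i`
is measured along `k` together with qubit `j`, and along `k'` together with qubit `m`. -/
lemma sum_sq_trace_pair_add_le_one {n : ℕ} {ρ : Matrix (Fin n → Fin 2) (Fin n → Fin 2) ℂ}
    (hρ : IsDensityMatrix ρ) {i j m : Fin n} (hij : i ≠ j) (him : i ≠ m) (hjm : j ≠ m)
    {k k' : Fin 2} (hk : k ≠ k') :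
    ∑ l, ((ρ * (onQubit (XY k) i * onQubit (XY l) j)).trace.re) ^ 2 +
      ∑ l, ((ρ * (onQubit (XY k') i * onQubit (XY l) m)).trace.re) ^ 2 ≤ 1 := by
  have hmul : ∀ {p q : Fin n} (_ : i ≠ p) (a b c d : Fin 2),
      onQubit (XY a) i * onQubit (XY b) p * (onQubit (XY c) i * onQubit (XY d) q) =
        onQubit (XY a * XY c) i * (onQubit (XY b) p * onQubit (XY d) q) := by
    intro p q hp a b c d
    rw [← onQubit_mul, mul_assoc, ← mul_assoc (onQubit (XY b) p), ← onQubit_comm _ _ hp]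
    simp only [mul_assoc]
  have hsame : ∀ {p : Fin n} (_ : i ≠ p) (a b c : Fin 2), b ≠ c →
      onQubit (XY a) i * onQubit (XY b) p * (onQubit (XY a) i * onQubit (XY c) p) +
        onQubit (XY a) i * onQubit (XY c) p * (onQubit (XY a) i * onQubit (XY b) p) = 0 := by
    intro p hp a b c hbc
    rw [hmul hp, hmul hp, ← mul_add, onQubit_mul, onQubit_mul, ← onQubit_add, XY_anticomm hbc,
      onQubit_zero, mul_zero]
  have hcross : ∀ b c : Fin 2,
      onQubit (XY k) i * onQubit (XY b) j * (onQubit (XY k') i * onQubit (XY c) m) +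
        onQubit (XY k') i * onQubit (XY c) m * (onQubit (XY k) i * onQubit (XY b) j) = 0 := by
    intro b c
    rw [hmul hij, hmul him, onQubit_comm _ _ hjm, ← add_mul, ← onQubit_add, XY_anticomm hk,
      onQubit_zero, zero_mul]
  have key := sum_sq_trace_le_one hρ.1 hρ.2
    (Sum.elim (fun l => onQubit (XY k) i * onQubit (XY l) j)
      (fun l => onQubit (XY k') i * onQubit (XY l) m)) ?_ ?_ ?_
  · simpa [Fintype.sum_sum_type] using key
  · rintro (l | l)
    · simp [onQubit_conjTranspose, XY_isHermitian, onQubit_comm _ _ hij]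
    · simp [onQubit_conjTranspose, XY_isHermitian, onQubit_comm _ _ him]
  · rintro (l | l)
    · simp [hmul hij, onQubit_mul, XY_mul_self, onQubit_one]
    · simp [hmul him, onQubit_mul, XY_mul_self, onQubit_one]
  · rintro (l | l) (l' | l') hne
    · exact hsame hij k l l' fun h => hne (congrArg _ h)
    · exact hcross l l'
    · exact (add_comm _ _).trans (hcross l' l)
    · exact hsame him k' l l' fun h => hne (congrArg _ h)

/-- Monogamy of the xy-plane Bell strengths of two pairs sharing a qubit, for any number of
qubits. -/
lemma T2pair_add_T2pair_le_two {n : ℕ} {ρ : Matrix (Fin n → Fin 2) (Fin n → Fin 2) ℂ}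
    (hρ : IsDensityMatrix ρ) {i j m : Fin n} (hij : i ≠ j) (him : i ≠ m) (hjm : j ≠ m) :
    T2pair ρ i j + T2pair ρ i m ≤ 2 := by
  have h₀ := sum_sq_trace_pair_add_le_one hρ hij him hjm (k := 0) (k' := 1) (by decide)
  have h₁ := sum_sq_trace_pair_add_le_one hρ hij him hjm (k := 1) (k' := 0) (by decide)
  rw [T2pair, T2pair, Fin.sum_univ_two (fun k => ∑ l, _),
    Fin.sum_univ_two (fun k => ∑ l, _)]
  linarith

/-- **Elementary bipartite Bell monogamy.** For every 3-qubit density matrix,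
𝒯²₁₂(ρ) + 𝒯²₁₃(ρ) ≤ 2. -/
theorem elementary_bipartite_monogamy (ρ : Matrix (Fin 3 → Fin 2) (Fin 3 → Fin 2) ℂ)
    (hρ : IsDensityMatrix ρ) :
    T2pair ρ 0 1 + T2pair ρ 0 2 ≤ 2 := by
  exact T2pair_add_T2pair_le_two hρ (by decide) (by decide) (by decide)
end
end

section
/- Square-configuration tripartite monogamy: For every 4-qubit density matrix ρ, the xy-plane Bell strengths of the four triples obtained by omitting one qubit satisfy 𝒯²₁₂₃(ρ) + 𝒯²₂₃₄(ρ) + 𝒯²₃₄₁(ρ) + 𝒯²₄₁₂(ρ) ≤ 4. -/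
open Matrix Complex ComplexOrder

noncomputable section

/-- The tensor product of a family of single-qubit operators. -/
def tensorOp {n : ℕ} (f : Fin n → Matrix (Fin 2) (Fin 2) ℂ) :
    Matrix (Fin n → Fin 2) (Fin n → Fin 2) ℂ :=
  Matrix.of fun a b => ∏ s, f s (a s) (b s)

lemma tensorOp_mul {n : ℕ} (f g : Fin n → Matrix (Fin 2) (Fin 2) ℂ) :
    tensorOp f * tensorOp g = tensorOp (f * g) := by
  ext a b
  simp only [tensorOp, Matrix.mul_apply, Matrix.of_apply, Pi.mul_apply, Finset.prod_univ_sum,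
    Fintype.piFinset_univ, Finset.prod_mul_distrib]

lemma tensorOp_one {n : ℕ} : tensorOp (1 : Fin n → Matrix (Fin 2) (Fin 2) ℂ) = 1 := by
  ext a b
  simp only [tensorOp, Matrix.of_apply, Pi.one_apply, Matrix.one_apply, funext_iff]
  by_cases h : ∀ s, a s = b s
  · simp [h]
  · rw [if_neg h]
    push Not at h
    obtain ⟨s, hs⟩ := h
    exact Finset.prod_eq_zero (Finset.mem_univ s) (if_neg hs)

lemma tensorOp_smul {n : ℕ} (c : Fin n → ℂ) (f : Fin n → Matrix (Fin 2) (Fin 2) ℂ) :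
    tensorOp (fun s => c s • f s) = (∏ s, c s) • tensorOp f := by
  ext a b
  simp [tensorOp, Finset.prod_mul_distrib]

lemma tensorOp_conjTranspose {n : ℕ} (f : Fin n → Matrix (Fin 2) (Fin 2) ℂ) :
    (tensorOp f)ᴴ = tensorOp fun s => (f s)ᴴ := by
  ext a b
  simp [tensorOp, Matrix.conjTranspose_apply]

lemma onQubit_eq_tensorOp {n : ℕ} (M : Matrix (Fin 2) (Fin 2) ℂ) (i : Fin n) :
    onQubit M i = tensorOp (Function.update 1 i M) := by
  ext a b
  simp only [onQubit, tensorOp, Matrix.of_apply]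
  refine Finset.prod_congr rfl fun s _ => ?_
  by_cases h : s = i
  · subst h; simp
  · simp [h, Matrix.one_apply]

/-- The single-qubit operators `1`, `σ_x`, `σ_y`. -/
def pauli : Fin 3 → Matrix (Fin 2) (Fin 2) ℂ := ![1, pX, pY]

/-- The commutation sign of two of the operators `1`, `σ_x`, `σ_y`. -/
def pauliSign (a b : Fin 3) : ℤ := if a = 0 ∨ b = 0 ∨ a = b then 1 else -1

lemma pauli_conjTranspose (a : Fin 3) : (pauli a)ᴴ = pauli a := by
  fin_cases a <;> ext i j <;> fin_cases i <;> fin_cases j <;>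
    simp [pauli, pX, pY, Matrix.conjTranspose_apply]

lemma pauli_mul_self (a : Fin 3) : pauli a * pauli a = 1 := by
  fin_cases a <;> ext i j <;> fin_cases i <;> fin_cases j <;>
    simp [pauli, pX, pY, Matrix.mul_apply]

lemma pauli_mul_comm (a b : Fin 3) :
    pauli a * pauli b = (pauliSign a b : ℂ) • (pauli b * pauli a) := by
  fin_cases a <;> fin_cases b <;> ext i j <;> fin_cases i <;> fin_cases j <;>
    simp [pauli, pX, pY, Matrix.mul_apply, pauliSign]

/-- The tensor product of Pauli operators described by a word. -/
def pauliString {n : ℕ} (w : Fin n → Fin 3) : Matrix (Fin n → Fin 2) (Fin n → Fin 2) ℂ :=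
  tensorOp fun s => pauli (w s)

lemma pauliString_isHermitian {n : ℕ} (w : Fin n → Fin 3) : (pauliString w).IsHermitian := by
  simp [Matrix.IsHermitian, pauliString, tensorOp_conjTranspose, pauli_conjTranspose]

lemma pauliString_mul_self {n : ℕ} (w : Fin n → Fin 3) : pauliString w * pauliString w = 1 := by
  rw [pauliString, tensorOp_mul, ← tensorOp_one]
  exact congrArg tensorOp (funext fun s => pauli_mul_self (w s))

lemma pauliString_anticomm {n : ℕ} {v w : Fin n → Fin 3}
    (h : ∏ s, pauliSign (v s) (w s) = -1) :
    pauliString v * pauliString w = -(pauliString w * pauliString v) := by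
  have hc : (∏ s, (pauliSign (v s) (w s) : ℂ)) = -1 := by
    rw [← Int.cast_prod, h]; simp
  calc pauliString v * pauliString w
      = tensorOp fun s => (pauliSign (v s) (w s) : ℂ) • (pauli (w s) * pauli (v s)) := by
        rw [pauliString, pauliString, tensorOp_mul]
        exact congrArg tensorOp (funext fun s => pauli_mul_comm (v s) (w s))
    _ = -(pauliString w * pauliString v) := by
        rw [tensorOp_smul, hc, neg_one_smul, pauliString, pauliString, tensorOp_mul]
        rfl

lemma sq_sum_smul_of_anticomm {ι m : Type*} [Fintype ι] [Fintype m] [DecidableEq m]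
    (A : ι → Matrix m m ℂ) (hsq : ∀ i, A i * A i = 1)
    (hA : ∀ i j, i ≠ j → A i * A j = -(A j * A i)) (t : ι → ℝ) :
    (∑ i, (t i : ℂ) • A i) * (∑ i, (t i : ℂ) • A i) = ((∑ i, t i ^ 2 : ℝ) : ℂ) • 1 := by
  classical
  have hanti : ∀ i j, A i * A j + A j * A i = if i = j then (2 : ℂ) • 1 else 0 := by
    intro i j
    split_ifs with h
    · rw [h, hsq, two_smul]
    · rw [hA i j h, neg_add_cancel]
  have hexp : (∑ i, (t i : ℂ) • A i) * (∑ i, (t i : ℂ) • A i)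
      = ∑ i, ∑ j, ((t i : ℂ) * t j) • (A i * A j) := by
    simp only [Finset.sum_mul_sum, smul_mul_smul_comm]
  have hswap : ∑ i, ∑ j, ((t i : ℂ) * t j) • (A i * A j)
      = ∑ i, ∑ j, ((t i : ℂ) * t j) • (A j * A i) := by
    rw [Finset.sum_comm]
    simp only [mul_comm]
  have hdouble : (2 : ℂ) • ((∑ i, (t i : ℂ) • A i) * (∑ i, (t i : ℂ) • A i))
      = (2 : ℂ) • (((∑ i, t i ^ 2 : ℝ) : ℂ) • (1 : Matrix m m ℂ)) := by
    rw [hexp, two_smul]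
    nth_rewrite 2 [hswap]
    simp only [← Finset.sum_add_distrib, ← smul_add, hanti, smul_ite, smul_zero,
      Finset.sum_ite_eq, Finset.mem_univ, if_true, ← Finset.sum_smul, smul_smul]
    push_cast
    simp only [Finset.mul_sum]
    congr 1
    exact Finset.sum_congr rfl fun i _ => by ring
  exact smul_right_injective _ (two_ne_zero' ℂ) hdouble

/-- The squared expectation values of pairwise anticommuting Hermitian involutions
sum to at most one. -/
lemma sum_sq_expectation_le_one_of_anticomm {ι m : Type*} [Fintype ι] [Fintype m] [DecidableEq m]
    {ρ : Matrix m m ℂ} (hρ : ρ.PosSemidef) (htr : ρ.trace = 1)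
    (A : ι → Matrix m m ℂ) (hH : ∀ i, (A i).IsHermitian) (hsq : ∀ i, A i * A i = 1)
    (hA : ∀ i j, i ≠ j → A i * A j = -(A j * A i)) :
    ∑ i, (ρ * A i).trace.re ^ 2 ≤ 1 := by
  set t : ι → ℝ := fun i => (ρ * A i).trace.re with ht
  set B := ∑ i, (t i : ℂ) • A i with hB
  have hBB : B * B = ((∑ i, t i ^ 2 : ℝ) : ℂ) • 1 := sq_sum_smul_of_anticomm A hsq hA t
  have hBH : Bᴴ = B := by
    simp [hB, Matrix.conjTranspose_sum, Matrix.conjTranspose_smul, fun i => (hH i).eq]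
  have htB : (ρ * B).trace.re = ∑ i, t i ^ 2 := by
    simp [hB, Matrix.mul_sum, Matrix.trace_sum, ht, sq]
  have hpos : 0 ≤ ((1 - B) * ρ * (1 - B)ᴴ).trace.re :=
    (Complex.le_def.mp (hρ.mul_mul_conjTranspose_same (1 - B)).trace_nonneg).1
  have hexp : ((1 - B) * ρ * (1 - B)ᴴ).trace
      = 1 - 2 * (ρ * B).trace + ((∑ i, t i ^ 2 : ℝ) : ℂ) := by
    rw [Matrix.conjTranspose_sub, hBH, Matrix.conjTranspose_one, Matrix.mul_assoc,
      Matrix.trace_mul_comm, Matrix.mul_assoc,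
      show (1 - B) * (1 - B) = 1 - B - B + B * B by noncomm_ring, hBB]
    simp only [Matrix.mul_add, Matrix.mul_sub, Matrix.mul_one, Matrix.mul_smul, Matrix.trace_add,
      Matrix.trace_sub, Matrix.trace_smul, htr, smul_eq_mul]
    ring
  rw [hexp] at hpos
  simp only [Complex.add_re, Complex.sub_re, Complex.one_re, Complex.mul_re, Complex.re_ofNat,
    Complex.im_ofNat, zero_mul, sub_zero, Complex.ofReal_re, htB] at hpos
  linarith

/-- Four families of pairwise anticommuting words that together exhaust the words omitting exactly
one of four qubits: the word `squareWord c (i, b)` of the family `c` omits the qubit `i`. -/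
def squareWord (c : Fin 4) (x : Fin 4 × Fin 2) : Fin 4 → Fin 3 := fun s =>
  if s = x.1 then 0 else
    ((!![0, 0, 0, 0; 0, 0, 0, 1; 0, 1, 0, 0; 0, 0, 1, 0] : Matrix (Fin 4) (Fin 4) (Fin 2)) x.1 s
      + (if s = c then 1 else 0) + (if s = 0 then 1 else 0) + x.2).succ

lemma squareWord_sign (c : Fin 4) (x y : Fin 4 × Fin 2) (h : x ≠ y) :
    ∏ s, pauliSign (squareWord c x s) (squareWord c y s) = -1 := by
  revert c x y
  decide +kernel

/-- The word reading `k`, `l`, `p` along three cyclically consecutive qubits starting at `i`. -/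
def cyclicWord (i : Fin 4) (k l p : Fin 2) : Fin 4 → Fin 3 := fun s =>
  (![k.succ, l.succ, p.succ, 0] : Fin 4 → Fin 3) (s - i)

lemma sum_squareWord {M : Type*} [AddCommMonoid M] (f : (Fin 4 → Fin 3) → M) :
    ∑ c, ∑ x, f (squareWord c x) = ∑ i, ∑ k, ∑ l, ∑ p, f (cyclicWord i k l p) := by
  have h : (Finset.univ : Finset (Fin 4 × Fin 4 × Fin 2)).val.map
        (fun x => squareWord x.1 x.2) =
      (Finset.univ : Finset (Fin 4 × Fin 2 × Fin 2 × Fin 2)).val.map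
        (fun y => cyclicWord y.1 y.2.1 y.2.2.1 y.2.2.2) := by
    decide +kernel
  have hsum := congrArg (fun s => (s.map f).sum) h
  simp only [Multiset.map_map] at hsum
  change ∑ x : Fin 4 × Fin 4 × Fin 2, f (squareWord x.1 x.2) =
    ∑ y : Fin 4 × Fin 2 × Fin 2 × Fin 2, f (cyclicWord y.1 y.2.1 y.2.2.1 y.2.2.2) at hsum
  simpa only [Fintype.sum_prod_type] using hsum

lemma pauliString_cyclicWord (i : Fin 4) (k l p : Fin 2) :
    onQubit (XY k) i * onQubit (XY l) (i + 1) * onQubit (XY p) (i + 2) =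
      pauliString (cyclicWord i k l p) := by
  have hXY : ∀ k : Fin 2, XY k = pauli k.succ := by
    intro k; fin_cases k <;> rfl
  simp only [onQubit_eq_tensorOp, tensorOp_mul, pauliString, hXY]
  refine congrArg tensorOp (funext fun s => ?_)
  fin_cases i <;> fin_cases s <;> simp [cyclicWord] <;> simp [pauli]

lemma T2triple_eq_sum_cyclicWord (ρ : Matrix (Fin 4 → Fin 2) (Fin 4 → Fin 2) ℂ) (i : Fin 4) :
    T2triple ρ i (i + 1) (i + 2) =
      ∑ k, ∑ l, ∑ p, (ρ * pauliString (cyclicWord i k l p)).trace.re ^ 2 := by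
  simp only [T2triple, pauliString_cyclicWord]

/-- **Square-configuration tripartite monogamy.** For every 4-qubit density matrix,
𝒯²₁₂₃(ρ) + 𝒯²₂₃₄(ρ) + 𝒯²₃₄₁(ρ) + 𝒯²₄₁₂(ρ) ≤ 4. -/
theorem square_tripartite_monogamy (ρ : Matrix (Fin 4 → Fin 2) (Fin 4 → Fin 2) ℂ)
    (hρ : IsDensityMatrix ρ) :
    T2triple ρ 0 1 2 + T2triple ρ 1 2 3 + T2triple ρ 2 3 0 + T2triple ρ 3 0 1 ≤ 4 := by
  have hsum : T2triple ρ 0 1 2 + T2triple ρ 1 2 3 + T2triple ρ 2 3 0 + T2triple ρ 3 0 1 =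
      ∑ i : Fin 4, T2triple ρ i (i + 1) (i + 2) := by
    rw [Fin.sum_univ_four]; rfl
  have hfamily : ∀ c, ∑ x, (ρ * pauliString (squareWord c x)).trace.re ^ 2 ≤ 1 := fun c =>
    sum_sq_expectation_le_one_of_anticomm hρ.1 hρ.2 _ (fun _ => pauliString_isHermitian _)
      (fun _ => pauliString_mul_self _)
      (fun x y hxy => pauliString_anticomm (squareWord_sign c x y hxy))
  calc _ = ∑ c, ∑ x, (ρ * pauliString (squareWord c x)).trace.re ^ 2 := by
        simp only [hsum, T2triple_eq_sum_cyclicWord]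
        exact (sum_squareWord fun w => (ρ * pauliString w).trace.re ^ 2).symm
    _ ≤ ∑ _c : Fin 4, (1 : ℝ) := Finset.sum_le_sum fun c _ => hfamily c
    _ = 4 := by simp
end
end

section
/- Tightness of the general bipartite monogamy relation: Let |+⟩ = (|0⟩ + |1⟩)/√2 be the +1 eigenstate of σ_x and let ρ = (|+⟩⟨+|)^{⊗n} be the corresponding n-qubit product density matrix. Then for every pair of distinct qubits i ≠ j one has 𝒯²_{ij}(ρ) = 1; in particular T_{xx}^{(i,j)}(ρ) = 1 and T_{xy}^{(i,j)}(ρ) = T_{yx}^{(i,j)}(ρ) = T_{yy}^{(i,j)}(ρ) = 0, so that for every finite simple graph G on {1,…,n} the state ρ attains equality in the relation Σ_{e={u,v}∈E} (deg(u)+deg(v)−2) 𝒯²_{uv}(ρ) ≤ 2 Σ_v C(deg(v),2). -/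
open Matrix Complex ComplexOrder

noncomputable section

/-- The single-qubit density matrix |+⟩⟨+| of the +1 eigenstate |+⟩ = (|0⟩+|1⟩)/√2 of σ_x. -/
def plusProj : Matrix (Fin 2) (Fin 2) ℂ := !![1/2, 1/2; 1/2, 1/2]

/-- The n-qubit product density matrix (|+⟩⟨+|)^{⊗n}. -/
def plusPow (n : ℕ) : Matrix (Fin n → Fin 2) (Fin n → Fin 2) ℂ :=
  Matrix.of fun a b => ∏ s, plusProj (a s) (b s)

/-- The Kronecker product of a family of square matrices indexed by a finite type. -/
def piKronecker {ι m R : Type*} [Fintype ι] [CommSemiring R] (A : ι → Matrix m m R) :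
    Matrix (ι → m) (ι → m) R :=
  Matrix.of fun a b => ∏ s, A s (a s) (b s)

theorem piKronecker_mul {ι m R : Type*} [Fintype ι] [DecidableEq ι] [Fintype m]
    [CommSemiring R] (A B : ι → Matrix m m R) :
    piKronecker A * piKronecker B = piKronecker (A * B) := by
  ext a b
  simp only [piKronecker, Matrix.mul_apply, Matrix.of_apply, Pi.mul_apply,
    ← Finset.prod_mul_distrib]
  exact (Fintype.prod_sum fun s c => A s (a s) c * B s c (b s)).symm

theorem trace_piKronecker {ι m R : Type*} [Fintype ι] [DecidableEq ι] [Fintype m]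
    [CommSemiring R] (A : ι → Matrix m m R) :
    (piKronecker A).trace = ∏ s, (A s).trace := by
  simp only [piKronecker, Matrix.trace, Matrix.diag_apply, Matrix.of_apply]
  exact (Fintype.prod_sum fun s c => A s c c).symm

theorem onQubit_eq_piKronecker {n : ℕ} (M : Matrix (Fin 2) (Fin 2) ℂ) (i : Fin n) :
    onQubit M i = piKronecker (Pi.mulSingle i M) := by
  ext a b
  simp only [onQubit, piKronecker, Matrix.of_apply]
  refine Finset.prod_congr rfl fun s _ => ?_
  by_cases h : s = i
  · subst h; simp
  · simp [h, Matrix.one_apply]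

theorem plusPow_eq_piKronecker (n : ℕ) : plusPow n = piKronecker fun _ => plusProj := rfl

theorem trace_plusProj : plusProj.trace = 1 := by
  norm_num [plusProj, Matrix.trace_fin_two]

theorem trace_plusProj_mul_pX : (plusProj * pX).trace = 1 := by
  norm_num [plusProj, pX, Matrix.trace_fin_two]

theorem trace_plusProj_mul_pY : (plusProj * pY).trace = 0 := by
  simp [plusProj, pY, Matrix.trace_fin_two]

/-- Correlation functions of the product state factorize over distinct qubits. -/
theorem trace_plusPow_mul_onQubit_mul_onQubit {n : ℕ} (M N : Matrix (Fin 2) (Fin 2) ℂ)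
    {i j : Fin n} (hij : i ≠ j) :
    (plusPow n * (onQubit M i * onQubit N j)).trace
      = (plusProj * M).trace * (plusProj * N).trace := by
  rw [plusPow_eq_piKronecker, onQubit_eq_piKronecker, onQubit_eq_piKronecker,
    piKronecker_mul, piKronecker_mul, trace_piKronecker,
    Fintype.prod_eq_mul i j hij]
  · simp [hij, hij.symm]
  · rintro s ⟨hi, hj⟩
    simp [hi, hj, trace_plusProj]

theorem T2pair_plusPow {n : ℕ} {i j : Fin n} (hij : i ≠ j) : T2pair (plusPow n) i j = 1 := by
  simp [T2pair, XY, trace_plusPow_mul_onQubit_mul_onQubit _ _ hij, trace_plusProj_mul_pX,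
    trace_plusProj_mul_pY]

/-- Summing a vertex weight over the two ends of each edge counts each vertex with its degree. -/
theorem sum_edgeFinset_inf_add_sup {V R : Type*} [Fintype V] [LinearOrder V] [CommSemiring R]
    (G : SimpleGraph V) [DecidableRel G.Adj] (f : V → R) :
    ∑ e ∈ G.edgeFinset, (f e.inf + f e.sup) = ∑ v, G.degree v * f v := by
  have h_ends : ∀ e ∈ G.edgeFinset, f e.inf + f e.sup = ∑ v, if v ∈ e then f v else 0 := by
    intro e he
    induction e with | _ a b
    have hab : a ≠ b := (G.mem_edgeFinset.mp he : G.Adj a b).ne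
    have h_pair : (Finset.univ.filter fun v => v ∈ s(a, b)) = {a, b} := by ext; simp
    rw [← Finset.sum_filter, h_pair, Finset.sum_pair hab]
    rcases le_total a b with h | h <;> simp [h, add_comm]
  rw [Finset.sum_congr rfl h_ends, Finset.sum_comm]
  refine Finset.sum_congr rfl fun v _ => ?_
  rw [← Finset.sum_filter, Finset.sum_const, ← G.incidenceFinset_eq_filter,
    G.card_incidenceFinset_eq_degree, nsmul_eq_mul]

/-- **Tightness of the general bipartite monogamy relation.** The state ρ = (|+⟩⟨+|)^{⊗n}
has 𝒯²_{ij}(ρ) = 1 for every pair i ≠ j (with T_xx = 1 and T_xy = T_yx = T_yy = 0), and it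
attains equality in the general bipartite monogamy relation for every finite simple graph G. -/
theorem plusPow_saturates_general_monogamy {n : ℕ} (G : SimpleGraph (Fin n))
    [DecidableRel G.Adj] :
    (∀ i j : Fin n, i ≠ j →
      T2pair (plusPow n) i j = 1 ∧
      ((plusPow n * (onQubit pX i * onQubit pX j)).trace.re = 1) ∧
      ((plusPow n * (onQubit pX i * onQubit pY j)).trace.re = 0) ∧
      ((plusPow n * (onQubit pY i * onQubit pX j)).trace.re = 0) ∧
      ((plusPow n * (onQubit pY i * onQubit pY j)).trace.re = 0)) ∧
    ∑ e ∈ G.edgeFinset,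
        ((G.degree e.inf + G.degree e.sup : ℝ) - 2) * T2pair (plusPow n) e.inf e.sup
      = 2 * ∑ v : Fin n, ((G.degree v).choose 2 : ℝ) := by
  refine ⟨fun i j hij => ⟨T2pair_plusPow hij, ?_, ?_, ?_, ?_⟩, ?_⟩
  iterate 4
    simp [trace_plusPow_mul_onQubit_mul_onQubit _ _ hij, trace_plusProj_mul_pX,
      trace_plusProj_mul_pY]
  calc
    _ = ∑ e ∈ G.edgeFinset, (((G.degree e.inf : ℝ) - 1) + ((G.degree e.sup : ℝ) - 1)) := by
      refine Finset.sum_congr rfl fun e he => ?_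
      have h_ne : e.inf ≠ e.sup := by
        induction e with | _ a b
        simpa using (G.mem_edgeFinset.mp he : G.Adj a b).ne
      rw [T2pair_plusPow h_ne]
      ring
    _ = ∑ v, (G.degree v : ℝ) * ((G.degree v : ℝ) - 1) :=
      sum_edgeFinset_inf_add_sup G fun v => (G.degree v : ℝ) - 1
    _ = _ := by
      rw [Finset.mul_sum]
      refine Finset.sum_congr rfl fun v _ => ?_
      rw [Nat.cast_choose_two]
      ring
end
end
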